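/- Let x, x', y, y' ∈ W with x ≤ x' and y ≤ y' in Bruhat order. Then x ∗ y ≤ x' ∗ y', x' ▷ y ≤ x ▷ y', and x ◁ y' ≤ x' ◁ y. -/

import Mathlib

/-! Common setup: a finite Coxeter system, Bruhat order, and the sets
`{u * y : u ≤ x}` and `{x * v : v ≤ y}` used to characterize the
Demazure product `∗` and the operations `▷`, `◁`. -/

/-- The Bruhat order on a Coxeter group: the reflexive-transitive closure of
the relation `u → u * t`, where `t` is a reflection and right multiplication
by `t` increases length. -/
def CoxeterSystem.bruhatLE {B W : Type*} [Group W] {M : CoxeterMatrix B}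
    (cs : CoxeterSystem M W) : W → W → Prop :=
  Relation.ReflTransGen
    (fun u v => ∃ t, cs.IsReflection t ∧ v = u * t ∧ cs.length u < cs.length v)

/-- The set `{u * y : u ∈ W, u ≤ x}`. -/
def CoxeterSystem.lset {B W : Type*} [Group W] {M : CoxeterMatrix B}
    (cs : CoxeterSystem M W) (x y : W) : Set W :=
  {z | ∃ u, cs.bruhatLE u x ∧ z = u * y}

/-- The set `{x * v : v ∈ W, v ≤ y}`. -/
def CoxeterSystem.rset {B W : Type*} [Group W] {M : CoxeterMatrix B}
    (cs : CoxeterSystem M W) (x y : W) : Set W :=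
  {z | ∃ v, cs.bruhatLE v y ∧ z = x * v}

namespace CoxeterSystem

variable {B W : Type*} [Group W] {M : CoxeterMatrix B} (cs : CoxeterSystem M W)

section InversionParity

open Classical in
/-- The action of a simple reflection on `W × ZMod 2`: conjugation on the first factor, and a
sign change at the simple reflection itself. -/
noncomputable def signedConj (i : B) : Equiv.Perm (W × ZMod 2) :=
  Function.Involutive.toPerm
    (fun p => (cs.simple i * p.1 * cs.simple i, p.2 + if p.1 = cs.simple i then 1 else 0)) <| by
      intro p
      have h : cs.simple i * p.1 * cs.simple i = cs.simple i ↔ p.1 = cs.simple i := by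
        rw [mul_eq_right, ← cs.inv_simple i, inv_mul_eq_one, inv_simple, eq_comm]
      refine Prod.ext ?_ ?_
      · simp [mul_assoc]
      · simp only [h, add_assoc, CharTwo.add_self_eq_zero, add_zero]

open Classical in
theorem signedConj_apply (i : B) (p : W × ZMod 2) :
    cs.signedConj i p =
      (cs.simple i * p.1 * cs.simple i, p.2 + if p.1 = cs.simple i then 1 else 0) :=
  rfl

theorem inv_pow_mul_simple (i i' : B) (k : ℕ) :
    ((cs.simple i * cs.simple i') ^ k)⁻¹ * cs.simple i' =
      cs.simple i' * (cs.simple i * cs.simple i') ^ k := by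
  have h : SemiconjBy (cs.simple i') (cs.simple i * cs.simple i')
      (cs.simple i * cs.simple i')⁻¹ := by
    simp [SemiconjBy, mul_assoc]
  rw [← inv_pow]
  exact (h.pow_right k).eq.symm

theorem conj_pow_eq_simple_iff (i i' : B) (k : ℕ) (t : W) :
    (cs.simple i * cs.simple i') ^ k * t * ((cs.simple i * cs.simple i') ^ k)⁻¹ = cs.simple i' ↔
      t = cs.simple i' * (cs.simple i * cs.simple i') ^ (2 * k) := by
  rw [two_mul, pow_add, ← mul_assoc, ← inv_pow_mul_simple, mul_inv_eq_iff_eq_mul, mul_assoc,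
    eq_inv_mul_iff_mul_eq]

theorem conj_pow_eq_simple_conj_iff (i i' : B) (k : ℕ) (t : W) :
    cs.simple i' *
        ((cs.simple i * cs.simple i') ^ k * t * ((cs.simple i * cs.simple i') ^ k)⁻¹) *
        cs.simple i' = cs.simple i ↔
      t = cs.simple i' * (cs.simple i * cs.simple i') ^ (2 * k + 1) := by
  have h : cs.simple i' * (cs.simple i * cs.simple i') ^ (2 * k + 1) =
      ((cs.simple i * cs.simple i') ^ k)⁻¹ * (cs.simple i' * cs.simple i * cs.simple i') *
        (cs.simple i * cs.simple i') ^ k := by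
    rw [show 2 * k + 1 = k + 1 + k by ring, pow_add, pow_succ, ← mul_assoc, ← mul_assoc,
      ← inv_pow_mul_simple]
    simp only [mul_assoc]
  rw [h]
  generalize (cs.simple i * cs.simple i') ^ k = g
  constructor
  · intro e
    simp [← e, mul_assoc]
  · rintro rfl
    simp [mul_assoc]

open Classical in
theorem signedConj_mul_pow_apply (i i' : B) (k : ℕ) (p : W × ZMod 2) :
    ((cs.signedConj i * cs.signedConj i') ^ k) p =
      ((cs.simple i * cs.simple i') ^ k * p.1 * ((cs.simple i * cs.simple i') ^ k)⁻¹,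
        p.2 + ∑ j ∈ Finset.range (2 * k),
          if p.1 = cs.simple i' * (cs.simple i * cs.simple i') ^ j then 1 else 0) := by
  induction k with
  | zero => simp
  | succ k ih =>
    rw [pow_succ', Equiv.Perm.mul_apply, ih, Equiv.Perm.mul_apply]
    simp only [signedConj_apply, conj_pow_eq_simple_iff, conj_pow_eq_simple_conj_iff]
    rw [show 2 * (k + 1) = 2 * k + 1 + 1 by ring, Finset.sum_range_succ, Finset.sum_range_succ]
    refine Prod.ext ?_ ?_
    · simp [pow_succ', mul_assoc]
    · simp only [add_assoc]

theorem isLiftable_signedConj : M.IsLiftable cs.signedConj := by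
  classical
  intro i i'
  ext1 p
  rw [signedConj_mul_pow_apply, two_mul, Finset.sum_range_add]
  simp only [pow_add, simple_mul_simple_pow, one_mul, CharTwo.add_self_eq_zero]
  simp

/-- The action of a Coxeter group on `W × ZMod 2` by signed conjugation. -/
noncomputable def signedConjHom : W →* Equiv.Perm (W × ZMod 2) :=
  cs.lift ⟨cs.signedConj, cs.isLiftable_signedConj⟩

/-- The parity of the number of occurrences of `t` in the right inversion sequence of any word
for `w`. -/
noncomputable def inversionParity (w t : W) : ZMod 2 := (cs.signedConjHom w (t, 0)).2

open Classical in
theorem signedConjHom_wordProd_apply (ω : List B) (p : W × ZMod 2) :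
    cs.signedConjHom (cs.wordProd ω) p =
      (cs.wordProd ω * p.1 * (cs.wordProd ω)⁻¹, p.2 + ((cs.rightInvSeq ω).count p.1 : ℕ)) := by
  induction ω with
  | nil => simp
  | cons i ω ih =>
    rw [wordProd_cons, map_mul, Equiv.Perm.mul_apply, ih, signedConjHom,
      lift_apply_simple]
    refine Prod.ext ?_ ?_
    · simp [signedConj_apply, mul_assoc]
    · have h : cs.wordProd ω * p.1 * (cs.wordProd ω)⁻¹ = cs.simple i ↔
          (cs.wordProd ω)⁻¹ * cs.simple i * cs.wordProd ω = p.1 := by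
        rw [mul_inv_eq_iff_eq_mul, ← eq_inv_mul_iff_mul_eq, mul_assoc, eq_comm]
      simp only [signedConj_apply, h, rightInvSeq, List.count_cons, beq_iff_eq]
      split_ifs <;> simp [add_assoc]

theorem signedConjHom_apply (w : W) (p : W × ZMod 2) :
    cs.signedConjHom w p = (w * p.1 * w⁻¹, p.2 + cs.inversionParity w p.1) := by
  classical
  obtain ⟨ω, rfl⟩ := cs.wordProd_surjective w
  simp [inversionParity, signedConjHom_wordProd_apply]

theorem inversionParity_mul (v w t : W) :
    cs.inversionParity (v * w) t =
      cs.inversionParity w t + cs.inversionParity v (w * t * w⁻¹) := by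
  rw [inversionParity, map_mul, Equiv.Perm.mul_apply,
    signedConjHom_apply, signedConjHom_apply]
  simp

theorem inversionParity_one (t : W) : cs.inversionParity 1 t = 0 := by
  simp [inversionParity]

open Classical in
theorem inversionParity_simple (i : B) (t : W) :
    cs.inversionParity (cs.simple i) t = if t = cs.simple i then 1 else 0 := by
  simp [inversionParity, signedConjHom, signedConj_apply]

theorem IsReflection.inversionParity_self {t : W} (ht : cs.IsReflection t) :
    cs.inversionParity t t = 1 := by
  classical
  obtain ⟨w, i, rfl⟩ := ht
  have h := cs.inversionParity_mul w w⁻¹ (w * cs.simple i * w⁻¹)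
  rw [mul_inv_cancel, inversionParity_one] at h
  rw [inversionParity_mul, inversionParity_mul]
  simp only [mul_assoc, inv_mul_cancel_left, inv_mul_cancel, mul_one, one_mul, inv_inv,
    simple_mul_simple_self, inversionParity_simple, if_true, inv_simple] at h ⊢
  rw [add_left_comm, ← h, add_zero]

theorem length_mul_lt_of_inversionParity_ne_zero {w t : W} (h : cs.inversionParity w t ≠ 0) :
    cs.length (w * t) < cs.length w := by
  classical
  obtain ⟨ω, hω, rfl⟩ := cs.exists_isReduced w
  rw [inversionParity, signedConjHom_wordProd_apply] at h
  refine (cs.isRightInversion_of_mem_rightInvSeq hω ?_).2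
  by_contra hmem
  simp [List.count_eq_zero_of_not_mem hmem] at h

theorem IsReflection.inversionParity_eq_zero_iff {t : W} (ht : cs.IsReflection t) (w : W) :
    cs.inversionParity w t = 0 ↔ cs.length w < cs.length (w * t) := by
  constructor
  · intro h
    have := cs.length_mul_lt_of_inversionParity_ne_zero (w := w * t) (t := t) (by
      rw [inversionParity_mul, IsReflection.inversionParity_self cs ht]
      simp [h])
    simpa [mul_assoc, ht.mul_self] using this
  · intro h
    by_contra hne
    exact (cs.length_mul_lt_of_inversionParity_ne_zero hne).not_gt h

/-- A reflection whose inversion status changes under left multiplication by a simple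
reflection is determined. -/
theorem IsReflection.simple_mul_eq_mul {t : W} (ht : cs.IsReflection t) {w : W} {i : B}
    (h : cs.length w < cs.length (w * t))
    (h' : ¬ cs.length (cs.simple i * w) < cs.length (cs.simple i * w * t)) :
    cs.simple i * w = w * t := by
  classical
  rw [← IsReflection.inversionParity_eq_zero_iff cs ht] at h h'
  rw [inversionParity_mul, h, inversionParity_simple, zero_add] at h'
  rw [← mul_inv_eq_iff_eq_mul.mp (show w * t * w⁻¹ = cs.simple i by
    by_contra hne
    exact h' (if_neg hne))]

end InversionParity

section Bruhat

variable {cs}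

theorem bruhatLE.trans {a b c : W} (h : cs.bruhatLE a b) (h' : cs.bruhatLE b c) :
    cs.bruhatLE a c :=
  Relation.ReflTransGen.trans h h'

theorem IsReflection.bruhatLE_mul {a t : W} (ht : cs.IsReflection t)
    (h : cs.length a < cs.length (a * t)) : cs.bruhatLE a (a * t) :=
  Relation.ReflTransGen.single ⟨t, ht, rfl, h⟩

theorem IsReflection.bruhatLE_mul_left {a t : W} (ht : cs.IsReflection t)
    (h : cs.length a < cs.length (t * a)) : cs.bruhatLE a (t * a) := by
  have e : t * a = a * (a⁻¹ * t * a⁻¹⁻¹) := by simp [mul_assoc]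
  rw [e] at h ⊢
  exact (ht.conj a⁻¹).bruhatLE_mul h

theorem bruhatLE.inv {a b : W} (h : cs.bruhatLE a b) : cs.bruhatLE a⁻¹ b⁻¹ := by
  induction h with
  | refl => exact Relation.ReflTransGen.refl
  | tail _ hbc ih =>
    obtain ⟨t, ht, rfl, hlt⟩ := hbc
    refine ih.trans ?_
    rw [mul_inv_rev, ht.inv]
    refine ht.bruhatLE_mul_left ?_
    rwa [← cs.length_inv, ← cs.length_inv (t * _), inv_inv, mul_inv_rev, inv_inv, ht.inv]

theorem IsReflection.simple_mul_bruhatLE_or_eq {a t : W} (ht : cs.IsReflection t)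
    (h : cs.length a < cs.length (a * t)) (i : B) :
    cs.bruhatLE (cs.simple i * a) (cs.simple i * (a * t)) ∨ cs.simple i * a = a * t := by
  by_cases h' : cs.length (cs.simple i * a) < cs.length (cs.simple i * a * t)
  · left
    rw [← mul_assoc]
    exact ht.bruhatLE_mul h'
  · exact Or.inr (IsReflection.simple_mul_eq_mul cs ht h h')

theorem bruhatLE.simple_mul_le_or {a b : W} (h : cs.bruhatLE a b) (i : B) :
    cs.bruhatLE (cs.simple i * a) b ∨ cs.bruhatLE (cs.simple i * a) (cs.simple i * b) := by
  induction h with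
  | refl => exact Or.inr Relation.ReflTransGen.refl
  | tail _ hbc ih =>
    obtain ⟨t, ht, rfl, hlt⟩ := hbc
    rcases ih with ih | ih
    · exact Or.inl (ih.trans (ht.bruhatLE_mul hlt))
    · rcases ht.simple_mul_bruhatLE_or_eq hlt i with h' | h'
      · exact Or.inr (ih.trans h')
      · exact Or.inl (h' ▸ ih)

theorem bruhatLE.le_simple_mul_or {a b : W} (h : cs.bruhatLE a b) (i : B) :
    cs.bruhatLE a (cs.simple i * b) ∨ cs.bruhatLE (cs.simple i * a) (cs.simple i * b) := by
  induction h with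
  | refl => exact Or.inr Relation.ReflTransGen.refl
  | tail hab hbc ih =>
    obtain ⟨t, ht, rfl, hlt⟩ := hbc
    rcases ht.simple_mul_bruhatLE_or_eq hlt i with h' | h'
    · exact ih.imp (fun k => k.trans h') (fun k => k.trans h')
    · left
      rwa [← h', simple_mul_simple_cancel_left]

/-- Induction on a Coxeter group by left multiplication by length-increasing simple
reflections. -/
theorem left_simple_induction {P : W → Prop} (one : P 1)
    (simple_mul : ∀ u i, cs.bruhatLE u (cs.simple i * u) → P u → P (cs.simple i * u)) (u : W) :
    P u := by
  induction hn : cs.length u using Nat.strong_induction_on generalizing u with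
  | _ n ih =>
    by_cases hu : u = 1
    · exact hu ▸ one
    obtain ⟨i, hi⟩ := cs.exists_leftDescent_of_ne_one hu
    have h := simple_mul (cs.simple i * u) i
      ((cs.isReflection_simple i).bruhatLE_mul_left (by
        rwa [simple_mul_simple_cancel_left]))
      (ih _ (hn ▸ hi) _ rfl)
    simpa using h

theorem bruhatLE.simple_mul_le_simple_mul {u v : W} (h : cs.bruhatLE u v) {i : B}
    (hv : cs.bruhatLE v (cs.simple i * v)) :
    cs.bruhatLE (cs.simple i * u) (cs.simple i * v) :=
  (h.simple_mul_le_or i).elim (fun k => k.trans hv) id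

theorem bruhatLE.exists_mul_le_mul {y y' : W} (hy : cs.bruhatLE y y') (u : W) :
    ∃ u', cs.bruhatLE u' u ∧ cs.bruhatLE (u * y) (u' * y') := by
  induction u using left_simple_induction (cs := cs) with
  | one => exact ⟨1, Relation.ReflTransGen.refl, by simpa using hy⟩
  | simple_mul u i hu ih =>
    obtain ⟨u', hu', h⟩ := ih
    rcases h.simple_mul_le_or i with h | h
    · exact ⟨u', hu'.trans hu, by rwa [mul_assoc]⟩
    · exact ⟨cs.simple i * u', hu'.simple_mul_le_simple_mul hu, by rwa [mul_assoc, mul_assoc]⟩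

theorem bruhatLE.exists_mul_le_mul' {y y' : W} (hy : cs.bruhatLE y y') (u : W) :
    ∃ u', cs.bruhatLE u' u ∧ cs.bruhatLE (u' * y) (u * y') := by
  induction u using left_simple_induction (cs := cs) with
  | one => exact ⟨1, Relation.ReflTransGen.refl, by simpa using hy⟩
  | simple_mul u i hu ih =>
    obtain ⟨u', hu', h⟩ := ih
    rcases h.le_simple_mul_or i with h | h
    · exact ⟨u', hu'.trans hu, by rwa [mul_assoc]⟩
    · exact ⟨cs.simple i * u', hu'.simple_mul_le_simple_mul hu, by rwa [mul_assoc, mul_assoc]⟩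

theorem bruhatLE.exists_mul_right_le_mul {x x' : W} (hx : cs.bruhatLE x x') (v : W) :
    ∃ v', cs.bruhatLE v' v ∧ cs.bruhatLE (x * v') (x' * v) := by
  obtain ⟨u, hu, h⟩ := hx.inv.exists_mul_le_mul' v⁻¹
  exact ⟨u⁻¹, by simpa using hu.inv, by simpa using h.inv⟩

end Bruhat

end CoxeterSystem

/-- Monotonicity: if `x ≤ x'` and `y ≤ y'` in Bruhat order, then
`x ∗ y ≤ x' ∗ y'`, `x' ▷ y ≤ x ▷ y'`, and `x ◁ y' ≤ x' ◁ y`. -/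
theorem star_rtr_ltr_monotone {B W : Type*} [Group W] [Finite W] {M : CoxeterMatrix B}
    (cs : CoxeterSystem M W) (star rtr ltr : W → W → W)
    (hstar : ∀ x y : W, star x y ∈ cs.lset x y ∧
      ∀ z ∈ cs.lset x y, cs.bruhatLE z (star x y))
    (hrtr : ∀ x y : W, rtr x y ∈ cs.lset x y ∧
      ∀ z ∈ cs.lset x y, cs.bruhatLE (rtr x y) z)
    (hltr : ∀ x y : W, ltr x y ∈ cs.rset x y ∧
      ∀ z ∈ cs.rset x y, cs.bruhatLE (ltr x y) z)
    (x x' y y' : W) (hx : cs.bruhatLE x x') (hy : cs.bruhatLE y y') :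
    cs.bruhatLE (star x y) (star x' y') ∧
    cs.bruhatLE (rtr x' y) (rtr x y') ∧
    cs.bruhatLE (ltr x y') (ltr x' y) := by
  refine ⟨?_, ?_, ?_⟩
  · obtain ⟨u, hu, e⟩ := (hstar x y).1
    obtain ⟨u', hu', h⟩ := hy.exists_mul_le_mul u
    rw [e]
    exact h.trans ((hstar x' y').2 _ ⟨u', (hu'.trans hu).trans hx, rfl⟩)
  · obtain ⟨u, hu, e⟩ := (hrtr x y').1
    obtain ⟨u', hu', h⟩ := hy.exists_mul_le_mul' u
    rw [e]
    exact ((hrtr x' y).2 _ ⟨u', (hu'.trans hu).trans hx, rfl⟩).trans h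
  · obtain ⟨v, hv, e⟩ := (hltr x' y).1
    obtain ⟨v', hv', h⟩ := hx.exists_mul_right_le_mul v
    rw [e]
    exact ((hltr x y').2 _ ⟨v', (hv'.trans hv).trans hy, rfl⟩).trans h
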